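/- For every continuous function f : ℝ → ℝ, the integral of f(3x² - 2x³) over the interval [-1/2, 3/2] equals twice the integral of f(3x² - 2x³) over the interval [0, 1]; that is, ∫_{-1/2}^{3/2} f(3x² - 2x³) dx = 2 ∫_{0}^{1} f(3x² - 2x³) dx. -/

import Mathlib

open Real in
/-- Chebyshev substitution: `x = 1/2 + cos t` turns `3x² - 2x³` into `(1 - cos 3t) / 2`. -/
lemma integral_chebyshev_substitution {f : ℝ → ℝ} (hf : Continuous f) (a s b : ℝ)
    (h : ∀ t, cos (3 * (a + s * t)) = cos (3 * t)) :
    ∫ x in (1 / 2 + cos a)..(1 / 2 + cos (a + s * b)), f (3 * x ^ 2 - 2 * x ^ 3) =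
      ∫ t in (0 : ℝ)..b, f ((1 - cos (3 * t)) / 2) * -(s * sin (a + s * t)) := by
  have hd : ∀ t ∈ Set.uIcc 0 b,
      HasDerivAt (fun t ↦ 1 / 2 + cos (a + s * t)) (-(s * sin (a + s * t))) t := fun t _ ↦ by
    have h₁ : HasDerivAt (fun t ↦ a + s * t) s t := by
      simpa using ((hasDerivAt_id t).const_mul s).const_add a
    exact (h₁.cos.const_add (1 / 2)).congr_deriv (by ring)
  have key := intervalIntegral.integral_comp_mul_deriv
    (g := fun x ↦ f (3 * x ^ 2 - 2 * x ^ 3)) hd (by fun_prop) (by fun_prop)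
  simp only [mul_zero, add_zero] at key
  rw [← key]
  refine intervalIntegral.integral_congr fun t _ ↦ ?_
  simp only [Function.comp_apply]
  rw [← h t, cos_three_mul]
  ring_nf

open Real in
theorem ruehr_integral (f : ℝ → ℝ) (hf : Continuous f) :
    ∫ x in (-1/2 : ℝ)..(3/2 : ℝ), f (3 * x ^ 2 - 2 * x ^ 3) =
      2 * ∫ x in (0 : ℝ)..(1 : ℝ), f (3 * x ^ 2 - 2 * x ^ 3) := by
  have hcos : cos (2 * π / 3) = -1 / 2 := by
    rw [show 2 * π / 3 = π - π / 3 by ring, cos_pi_sub, cos_pi_div_three]; norm_num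
  have right := integral_chebyshev_substitution hf 0 1 (π / 3) fun t ↦ by simp
  have middle := integral_chebyshev_substitution hf (2 * π / 3) (-1) (π / 3) fun t ↦ by
    rw [show 3 * (2 * π / 3 + -1 * t) = 2 * π - 3 * t by ring, cos_two_pi_sub]
  have left := integral_chebyshev_substitution hf (2 * π / 3) 1 (π / 3) fun t ↦ by
    rw [show 3 * (2 * π / 3 + 1 * t) = 3 * t + 2 * π by ring, cos_add_two_pi]
  rw [show 0 + 1 * (π / 3) = π / 3 by ring, cos_zero, cos_pi_div_three] at right
  rw [show 2 * π / 3 + -1 * (π / 3) = π / 3 by ring, hcos, cos_pi_div_three] at middle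
  rw [show 2 * π / 3 + 1 * (π / 3) = π by ring, hcos, cos_pi] at left
  norm_num only at right middle left
  have hint : ∀ a b : ℝ, IntervalIntegrable (fun x ↦ f (3 * x ^ 2 - 2 * x ^ 3))
      MeasureTheory.volume a b := fun a b ↦ Continuous.intervalIntegrable (by fun_prop) a b
  have outer : (∫ x in (0 : ℝ)..(-1 / 2), f (3 * x ^ 2 - 2 * x ^ 3)) +
      ∫ x in (3 / 2 : ℝ)..1, f (3 * x ^ 2 - 2 * x ^ 3) =
      -∫ x in (0 : ℝ)..1, f (3 * x ^ 2 - 2 * x ^ 3) := by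
    norm_num only
    rw [left, right, middle, ← intervalIntegral.integral_add
      (Continuous.intervalIntegrable (by fun_prop) _ _)
      (Continuous.intervalIntegrable (by fun_prop) _ _), ← intervalIntegral.integral_neg]
    refine intervalIntegral.integral_congr fun t _ ↦ ?_
    simp only [sin_add, hcos, neg_mul, one_mul, sin_neg, cos_neg, sin_zero, cos_zero]
    ring
  rw [intervalIntegral.integral_symm (-1 / 2) 0, intervalIntegral.integral_symm 1 (3 / 2)] at outer
  rw [← intervalIntegral.integral_add_adjacent_intervals (hint (-1 / 2) 0) (hint 0 (3 / 2)),
    ← intervalIntegral.integral_add_adjacent_intervals (hint 0 1) (hint 1 (3 / 2))]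
  linarith
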